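/- arXiv:1303.7460 — 2 statements merged into one kernel-verified Lean document; each statement's English description precedes it below -/
import Mathlib

section
/- Define f : ℝ → ℝ by f(z) = (1 − z)^5 − (75/16) · z² · (1 − z)². Then for every z with 0 < z ≤ 1/4 one has f(z) ≥ f(1/4), and f(1/4) = 297/4096. Equivalently, the function z ↦ f(z)⁻¹ attains its maximal value 4096/297 on the interval (0, 1/4] at z = 1/4. -/
/-- The polynomial `f(z) = (1 − z)^5 − (75/16) z² (1 − z)²` attains its minimum on `(0, 1/4]`
at `z = 1/4`, where its value is `297/4096`; equivalently `f(z)⁻¹` attains its maximal value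
`4096/297` on `(0, 1/4]` at `z = 1/4`. -/
theorem extremal_dim40_poly_min
    (f : ℝ → ℝ) (hf : ∀ z : ℝ, f z = (1 - z) ^ 5 - 75 / 16 * z ^ 2 * (1 - z) ^ 2) :
    (∀ z : ℝ, 0 < z → z ≤ 1 / 4 → f (1 / 4) ≤ f z) ∧ f (1 / 4) = 297 / 4096 := by
  have h4 : f (1 / 4) = 297 / 4096 := by rw [hf]; norm_num
  refine ⟨fun z h0 h1 => ?_, h4⟩
  rw [h4, hf]
  have ha : (3 / 4 : ℝ) ^ 2 ≤ (1 - z) ^ 2 := pow_le_pow_left₀ (by norm_num) (by linarith) 2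
  have hb : (3 / 4 : ℝ) ^ 3 ≤ (1 - z) ^ 3 := pow_le_pow_left₀ (by norm_num) (by linarith) 3
  have hc : z ^ 2 ≤ (1 / 4 : ℝ) ^ 2 := pow_le_pow_left₀ h0.le h1 2
  have hg : (33 / 256 : ℝ) ≤ (1 - z) ^ 3 - 75 / 16 * z ^ 2 := by linarith
  calc (297 / 4096 : ℝ) = (3 / 4) ^ 2 * (33 / 256) := by norm_num
    _ ≤ (1 - z) ^ 2 * ((1 - z) ^ 3 - 75 / 16 * z ^ 2) :=
        mul_le_mul ha hg (by norm_num) (sq_nonneg _)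
    _ = _ := by ring
end

section
/- Define g : ℝ → ℝ by g(z) = 1 − 5z + (85/16)·z² − (5/8)·z³ + (5/16)·z⁴. Then for every z with 0 < z ≤ 1/4 one has g(z) ≥ g(1/4), and g(1/4) = 301/4096. Equivalently, the function z ↦ g(z)⁻¹ attains its maximal value 4096/301 on the interval (0, 1/4] at z = 1/4. -/
/-- The polynomial `g(z) = 1 − 5z + (85/16) z² − (5/8) z³ + (5/16) z⁴` attains its minimum on
`(0, 1/4]` at `z = 1/4`, where its value is `301/4096`; equivalently `g(z)⁻¹` attains its
maximal value `4096/301` on `(0, 1/4]` at `z = 1/4`. -/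
theorem odd_dim40_poly_min
    (g : ℝ → ℝ)
    (hg : ∀ z : ℝ, g z =
      1 - 5 * z + 85 / 16 * z ^ 2 - 5 / 8 * z ^ 3 + 5 / 16 * z ^ 4) :
    (∀ z : ℝ, 0 < z → z ≤ 1 / 4 → g (1 / 4) ≤ g z) ∧ g (1 / 4) = 301 / 4096 := by
  refine ⟨fun z h0 h1 => ?_, by rw [hg]; norm_num⟩
  have h2 : z ^ 2 ≤ 1 := by nlinarith
  have h3 : z ^ 3 ≤ 1 := pow_le_one₀ h0.le (by linarith)
  have hh : 0 ≤ 5 - 85 / 16 * (z + 1 / 4) + 5 / 8 * (z ^ 2 + z / 4 + 1 / 16)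
      - 5 / 16 * (z ^ 3 + z ^ 2 / 4 + z / 16 + 1 / 64) := by
    nlinarith [sq_nonneg z]
  have key := mul_nonneg (sub_nonneg.mpr h1) hh
  rw [hg, hg]
  linarith
end
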